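/- Let 𝒫 be a family of finite posets with h(𝒫) ≥ 2, and let Q ∈ 𝒫 be a poset with h(Q) = h(𝒫) and w(Q) = w(𝒫). For every ε > 0 and every finite poset P, if t(Q,P) < (ε/2)^{h(𝒫)·w(𝒫)²}, then there exists a subposet of P obtained by the removal of at most ε·|P|² edges that is C_{h(𝒫)}-free (and hence contains no member of 𝒫 as a subposet). -/

import Mathlib

/-- A strict partial order relation: irreflexive and transitive. -/
def IsStrictOrd {α : Type*} (r : α → α → Prop) : Prop :=
  (∀ x, ¬ r x x) ∧ (∀ ⦃x y z⦄, r x y → r y z → r x z)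

/-- An order-preserving map between relations. -/
def IsPosetHom {β : Type*} {α : Type*} (q : β → β → Prop) (p : α → α → Prop)
    (f : β → α) : Prop :=
  ∀ ⦃x y⦄, q x y → p (f x) (f y)

/-- The homomorphism density `t(Q,P)`: the probability that a uniformly random map from the
ground set of `Q` to the ground set of `P` is order-preserving. -/
noncomputable def homDensity {β : Type*} {α : Type*} [Fintype β] [Fintype α]
    (q : β → β → Prop) (p : α → α → Prop) : ℝ :=
  (Nat.card {f : β → α // IsPosetHom q p f} : ℝ) / (Fintype.card α : ℝ) ^ (Fintype.card β)

/-- `HasChain p h` means the relation `p` contains a copy of the chain `C_h`,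
i.e. elements `x_1 ≺ x_2 ≺ ⋯ ≺ x_h`. -/
def HasChain {α : Type*} (p : α → α → Prop) (h : ℕ) : Prop :=
  ∃ f : Fin h → α, ∀ ⦃i j : Fin h⦄, i < j → p (f i) (f j)

/-- The height of a poset: the maximum number of elements of a chain. -/
noncomputable def posetHeight {α : Type*} [Fintype α] (p : α → α → Prop) : ℕ :=
  sSup {n | HasChain p n}

/-- The width of a poset: the maximum number of elements of an antichain. -/
noncomputable def posetWidth {α : Type*} [Fintype α] (p : α → α → Prop) : ℕ :=
  sSup {n | ∃ s : Finset α, s.card = n ∧ ∀ x ∈ s, ∀ y ∈ s, ¬ p x y}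

/-- `SubposetRel p' p` : the relation `p'` is contained in `p` (a subposet on the same ground set,
obtained by removing edges). -/
def SubposetRel {α : Type*} (p' p : α → α → Prop) : Prop :=
  ∀ ⦃x y⦄, p' x y → p x y

/-- The number of removed edges: pairs `(x,y)` with `x ≺ y` in `p` but not in `p'`. -/
noncomputable def removedEdges {α : Type*} [Fintype α] (p p' : α → α → Prop) : ℕ :=
  Nat.card {e : α × α // p e.1 e.2 ∧ ¬ p' e.1 e.2}

/-- The chain `C_h` with `h` elements. -/
def chainRel (h : ℕ) : Fin h → Fin h → Prop := fun i j => i < j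

/-- `P` contains `Q` as a (not necessarily induced) subposet:
there is an injective order-preserving map from `Q` to `P`. -/
def ContainsAsSubposet {β : Type*} {α : Type*} (q : β → β → Prop)
    (p : α → α → Prop) : Prop :=
  ∃ f : β → α, Function.Injective f ∧ IsPosetHom q p f

/-- A finite poset with ground set `Fin n`. -/
structure FinPoset where
  n : ℕ
  rel : Fin n → Fin n → Prop
  strict : IsStrictOrd rel

/-- The height of a family of finite posets: the minimum height of a member. -/
noncomputable def famHeight (Ps : Set FinPoset) : ℕ :=
  sInf {m | ∃ P ∈ Ps, posetHeight P.rel = m}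

/-- The width of a family of finite posets: the minimum width of a member of minimum height. -/
noncomputable def famWidth (Ps : Set FinPoset) : ℕ :=
  sInf {m | ∃ P ∈ Ps, posetHeight P.rel = famHeight Ps ∧ posetWidth P.rel = m}

/-! ### Density inequalities -/

theorem density_pow_le_left_power {A B : Type*} [Fintype A] [Fintype B] [Nonempty B]
    (R : A → B → Prop) (w : ℕ) :
    ((Nat.card {x : A × B // R x.1 x.2} : ℝ) / (Fintype.card A * Fintype.card B)) ^ w ≤
      (Nat.card {x : (Fin w → A) × B // ∀ i, R (x.1 i) x.2} : ℝ) /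
        ((Fintype.card A : ℝ) ^ w * Fintype.card B) := by
  have hB : (Fintype.card B : ℝ) ≠ 0 := by exact_mod_cast Fintype.card_ne_zero
  have h1 : Nat.card {x : A × B // R x.1 x.2} = ∑ b : B, Nat.card {a : A // R a b} := by
    rw [← Nat.card_sigma]
    exact Nat.card_congr
      { toFun := fun x => ⟨x.1.2, x.1.1, x.2⟩
        invFun := fun x => ⟨(x.2.1, x.1), x.2.2⟩
        left_inv := fun _ => rfl
        right_inv := fun _ => rfl }
  have h2 : Nat.card {x : (Fin w → A) × B // ∀ i, R (x.1 i) x.2} =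
      ∑ b : B, Nat.card {a : A // R a b} ^ w := by
    have : ∀ b : B, Nat.card {a : A // R a b} ^ w = Nat.card (Fin w → {a : A // R a b}) := by
      intro b
      rw [Nat.card_fun, Nat.card_fin]
    simp_rw [this]
    rw [← Nat.card_sigma]
    exact Nat.card_congr
      { toFun := fun x => ⟨x.1.2, fun i => ⟨x.1.1 i, x.2 i⟩⟩
        invFun := fun x => ⟨(fun i => (x.2 i).1, x.1), fun i => (x.2 i).2⟩
        left_inv := fun _ => rfl
        right_inv := fun _ => rfl }
  have key := Real.pow_arith_mean_le_arith_mean_pow (Finset.univ : Finset B)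
    (fun _ => ((Fintype.card B : ℝ))⁻¹)
    (fun b => (Nat.card {a : A // R a b} : ℝ) / Fintype.card A)
    (fun _ _ => by positivity) (by simp [hB]) (fun _ _ => by positivity) w
  rw [h1, h2]
  convert key using 1
  · push_cast
    rw [← Finset.mul_sum, ← Finset.sum_div]
    congr 1
    rw [div_mul_eq_div_div, div_eq_inv_mul]
  · push_cast
    simp_rw [div_pow]
    rw [← Finset.mul_sum, ← Finset.sum_div, div_mul_eq_div_div, div_eq_inv_mul]

theorem density_pow_le_biclique_density {A B : Type*} [Fintype A] [Fintype B]
    [Nonempty A] [Nonempty B] (R : A → B → Prop) (w : ℕ) :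
    ((Nat.card {x : A × B // R x.1 x.2} : ℝ) / (Fintype.card A * Fintype.card B)) ^ (w ^ 2) ≤
      (Nat.card {x : (Fin w → A) × (Fin w → B) // ∀ i j, R (x.1 i) (x.2 j)} : ℝ) /
        ((Fintype.card A : ℝ) ^ w * (Fintype.card B : ℝ) ^ w) := by
  have h1 := density_pow_le_left_power R w
  have h2 := density_pow_le_left_power (fun (b : B) (a : Fin w → A) => ∀ i, R (a i) b) w
  have e1 : Nat.card {x : B × (Fin w → A) // ∀ i, R (x.2 i) x.1} =
      Nat.card {x : (Fin w → A) × B // ∀ i, R (x.1 i) x.2} :=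
    Nat.card_congr ((Equiv.prodComm _ _).subtypeEquiv (fun _ => Iff.rfl))
  have e2 : Nat.card {x : (Fin w → B) × (Fin w → A) // ∀ j i, R (x.2 i) (x.1 j)} =
      Nat.card {x : (Fin w → A) × (Fin w → B) // ∀ i j, R (x.1 i) (x.2 j)} :=
    Nat.card_congr ((Equiv.prodComm _ _).subtypeEquiv (fun _ => forall_comm))
  rw [e1, e2, Fintype.card_fun, Fintype.card_fin, Nat.cast_pow,
    mul_comm (Fintype.card B : ℝ), mul_comm ((Fintype.card B : ℝ) ^ w)] at h2
  rw [pow_two, pow_mul]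
  exact (pow_le_pow_left₀ (by positivity) h1 w).trans h2

/-- `f` is a walk in the relation `p`: consecutive values are related. -/
def IsPath {α : Type*} (p : α → α → Prop) {h : ℕ} (f : Fin h → α) : Prop :=
  ∀ k l : Fin h, k.val + 1 = l.val → p (f k) (f l)

theorem path_density_pow_le_blowup_density {α : Type*} [Fintype α] [Nonempty α]
    (p : α → α → Prop) (h w : ℕ) :
    ((Nat.card {f : Fin h → α // IsPath p f} : ℝ) / (Fintype.card α : ℝ) ^ h) ^ (w ^ 2) ≤
      (Nat.card {g : Fin w × Fin h → α //
          ∀ i j, ∀ k l : Fin h, k.val + 1 = l.val → p (g (i, k)) (g (j, l))} : ℝ) /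
        (Fintype.card α : ℝ) ^ (w * h) := by
  classical
  let E : Fin h → Prop := fun i => Even i.val
  let e := Equiv.piEquivPiSubtypeProd E (fun _ : Fin h => α)
  let R : ({i // E i} → α) → ({i // ¬ E i} → α) → Prop := fun a b => IsPath p (e.symm (a, b))
  have key := density_pow_le_biclique_density R w
  have hcard : (Fintype.card α : ℝ) ^ h =
      Fintype.card ({i // E i} → α) * Fintype.card ({i // ¬ E i} → α) := by
    have := Fintype.card_congr e
    rw [Fintype.card_prod, Fintype.card_fun, Fintype.card_fin] at this
    exact_mod_cast this
  have hN : Nat.card {x : ({i // E i} → α) × ({i // ¬ E i} → α) // R x.1 x.2} =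
      Nat.card {f : Fin h → α // IsPath p f} :=
    Nat.card_congr (e.symm.subtypeEquiv (fun _ => Iff.rfl))
  rw [hN, ← mul_pow, ← hcard, ← pow_mul, mul_comm h w] at key
  refine key.trans ?_
  gcongr
  have he : ∀ (a : {i // E i} → α) (b : {i // ¬ E i} → α) (k : Fin h),
      e.symm (a, b) k = if hk : E k then a ⟨k, hk⟩ else b ⟨k, hk⟩ := fun _ _ _ => rfl
  refine Nat.card_le_card_of_injective
    (fun x => ⟨fun ik => e.symm (x.1.1 ik.1, x.1.2 ik.1) ik.2, ?_⟩) ?_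
  · intro i j k l hkl
    by_cases hk : E k
    · have hl : ¬ E l := by
        simp only [E, ← hkl] at hk ⊢
        simpa [Nat.even_add_one] using hk
      have := x.2 i j k l hkl
      simpa [he, hk, hl] using this
    · have hl : E l := by
        simp only [E, ← hkl] at hk ⊢
        simpa [Nat.even_add_one] using hk
      have := x.2 j i k l hkl
      simpa [he, hk, hl] using this
  · rintro ⟨⟨a, b⟩, h1⟩ ⟨⟨a', b'⟩, h2⟩ hx
    have hx' : ∀ i, (a i, b i) = (a' i, b' i) := by
      intro i
      apply e.symm.injective
      funext k
      exact congrFun (Subtype.mk.inj hx) (i, k)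
    simp only [Prod.mk.injEq] at hx'
    simp only [Subtype.mk.injEq, Prod.mk.injEq]
    exact ⟨funext fun i => (hx' i).1, funext fun i => (hx' i).2⟩

theorem density_le_of_comp_embedding {α β γ : Type*} [Fintype α] [Fintype β] [Fintype γ]
    [Nonempty α] (ι : β → γ) (hι : Function.Injective ι)
    (S : (γ → α) → Prop) (T : (β → α) → Prop) (hST : ∀ f, S f → T (f ∘ ι)) :
    (Nat.card {f // S f} : ℝ) / (Fintype.card α : ℝ) ^ Fintype.card γ ≤
      (Nat.card {f // T f} : ℝ) / (Fintype.card α : ℝ) ^ Fintype.card β := by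
  classical
  have hα : (0 : ℝ) < Fintype.card α := by exact_mod_cast Fintype.card_pos
  have hle : Nat.card {f // S f} ≤
      Nat.card ({f // T f} × ({x // x ∉ Set.range ι} → α)) := by
    refine Nat.card_le_card_of_injective
      (fun f => (⟨f.1 ∘ ι, hST _ f.2⟩, fun x => f.1 x.1)) ?_
    rintro ⟨f, hf⟩ ⟨g, hg⟩ hfg
    simp only [Prod.mk.injEq, Subtype.mk.injEq] at hfg ⊢
    funext x
    by_cases hx : x ∈ Set.range ι
    · obtain ⟨y, rfl⟩ := hx
      exact congrFun hfg.1 y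
    · exact congrFun hfg.2 ⟨x, hx⟩
  rw [Nat.card_prod, Nat.card_fun, Nat.card_eq_fintype_card, Nat.card_eq_fintype_card,
    Nat.card_eq_fintype_card, Nat.card_eq_fintype_card] at hle
  have hγ : Fintype.card γ = Fintype.card β + Fintype.card {x // x ∉ Set.range ι} := by
    rw [Fintype.card_subtype_compl]
    have h1 : Fintype.card {x // x ∈ Set.range ι} = Fintype.card β :=
      Set.card_range_of_injective hι
    have h2 := Fintype.card_le_of_injective ι hι
    omega
  rw [div_le_div_iff₀ (by positivity) (by positivity), hγ, pow_add,
    Nat.card_eq_fintype_card, Nat.card_eq_fintype_card]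
  have : (Fintype.card {f // S f} : ℝ) ≤
      Fintype.card {f // T f} * (Fintype.card α : ℝ) ^ Fintype.card {x // x ∉ Set.range ι} := by
    exact_mod_cast hle
  calc _ ≤ _ := mul_le_mul_of_nonneg_right this (by positivity)
    _ = _ := by ring

/-! ### Chains, height and width -/

theorem HasChain.le_card {α : Type*} [Fintype α] {p : α → α → Prop} (hp : ∀ x, ¬ p x x)
    {n : ℕ} (h : HasChain p n) : n ≤ Fintype.card α := by
  obtain ⟨f, hf⟩ := h
  have : Function.Injective f := by
    intro i j hij
    rcases lt_trichotomy i j with h | h | h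
    · exact absurd (hij ▸ hf h) (hp _)
    · exact h
    · exact absurd (hij ▸ hf h) (hp _)
  simpa using Fintype.card_le_of_injective f this

theorem bddAbove_hasChain {α : Type*} [Fintype α] {p : α → α → Prop} (hp : ∀ x, ¬ p x x) :
    BddAbove {n | HasChain p n} :=
  ⟨Fintype.card α, fun _ h => HasChain.le_card hp h⟩

theorem hasChain_posetHeight {α : Type*} [Fintype α] {p : α → α → Prop} (hp : ∀ x, ¬ p x x) :
    HasChain p (posetHeight p) :=
  Nat.sSup_mem (s := {n | HasChain p n}) ⟨0, Fin.elim0, fun i => i.elim0⟩ (bddAbove_hasChain hp)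

theorem HasChain.mono {α : Type*} {p : α → α → Prop} {m n : ℕ} (hmn : m ≤ n)
    (h : HasChain p n) : HasChain p m := by
  obtain ⟨f, hf⟩ := h
  exact ⟨f ∘ Fin.castLE hmn, fun i j hij => hf (by simpa using hij)⟩

theorem hasChain_snoc {α : Type*} {p : α → α → Prop} {m : ℕ} {f : Fin m → α} {x : α}
    (hf : ∀ ⦃i j⦄, i < j → p (f i) (f j)) (hx : ∀ i, p (f i) x) :
    ∀ ⦃i j : Fin (m + 1)⦄, i < j →
      p (Fin.snoc (α := fun _ => α) f x i) (Fin.snoc (α := fun _ => α) f x j) := by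
  intro i j hij
  induction j using Fin.lastCases with
  | last =>
    induction i using Fin.lastCases with
    | last => exact absurd hij (lt_irrefl _)
    | cast i => simpa using hx i
  | cast j =>
    induction i using Fin.lastCases with
    | last => exact absurd hij (by simp [Fin.le_last])
    | cast i => simpa using hf (by simpa using hij)

theorem exists_level_function {α : Type*} [Fintype α] {p : α → α → Prop} (hp : IsStrictOrd p) :
    ∃ lev : α → Fin (posetHeight p), ∀ ⦃x y⦄, p x y → lev x < lev y := by
  let S : α → Set ℕ := fun x => {m | ∃ f : Fin m → α, (∀ ⦃i j⦄, i < j → p (f i) (f j)) ∧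
    ∀ i, p (f i) x}
  have hS0 : ∀ x, (S x).Nonempty := fun x => ⟨0, Fin.elim0, fun i => i.elim0, fun i => i.elim0⟩
  have hSb : ∀ x, BddAbove (S x) := fun x => ⟨Fintype.card α, by
    rintro m ⟨f, hf, -⟩
    exact HasChain.le_card hp.1 ⟨f, hf⟩⟩
  have hmem : ∀ x, sSup (S x) ∈ S x := fun x => Nat.sSup_mem (hS0 x) (hSb x)
  refine ⟨fun x => ⟨sSup (S x), ?_⟩, ?_⟩
  · obtain ⟨f, hf, hx⟩ := hmem x
    exact le_csSup (bddAbove_hasChain hp.1) ⟨_, hasChain_snoc hf hx⟩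
  · intro x y hxy
    obtain ⟨f, hf, hx⟩ := hmem x
    refine le_csSup (hSb y) ⟨Fin.snoc (α := fun _ => α) f x, hasChain_snoc hf hx, ?_⟩
    intro i
    induction i using Fin.lastCases with
    | last => simpa using hxy
    | cast i => simpa using hp.2 (hx i) hxy

theorem card_le_posetWidth {α : Type*} [Fintype α] {p : α → α → Prop} (s : Finset α)
    (hs : ∀ x ∈ s, ∀ y ∈ s, ¬ p x y) : s.card ≤ posetWidth p :=
  le_csSup ⟨Fintype.card α, by rintro n ⟨s, rfl, -⟩; exact s.card_le_univ⟩ ⟨s, rfl, hs⟩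

theorem exists_grid_embedding {α : Type*} [Fintype α] {p : α → α → Prop} (hp : IsStrictOrd p) :
    ∃ ι : α → Fin (posetWidth p) × Fin (posetHeight p), Function.Injective ι ∧
      ∀ ⦃x y⦄, p x y → (ι x).2 < (ι y).2 := by
  classical
  obtain ⟨lev, hlev⟩ := exists_level_function hp
  have hemb : ∀ k, Nonempty ({x // lev x = k} ↪ Fin (posetWidth p)) := by
    intro k
    apply Function.Embedding.nonempty_of_card_le
    rw [Fintype.card_fin, Fintype.card_subtype]
    apply card_le_posetWidth
    intro x hx y hy hxy
    have := hlev hxy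
    simp only [Finset.mem_filter, Finset.mem_univ, true_and] at hx hy
    rw [hx, hy] at this
    exact lt_irrefl _ this
  refine ⟨fun x => ((hemb (lev x)).some ⟨x, rfl⟩, lev x), ?_, hlev⟩
  intro x y hxy
  obtain ⟨h1, h2⟩ := Prod.mk.inj hxy
  have hinj : ∀ k l (hx : lev x = k) (hy : lev y = l), k = l →
      (hemb k).some ⟨x, hx⟩ = (hemb l).some ⟨y, hy⟩ → x = y := by
    rintro k l hx hy rfl h
    exact Subtype.mk.inj ((hemb k).some.injective h)
  exact hinj _ _ rfl rfl h2 h1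

/-! ### Removing edges -/

/-- The elements starting robustly many walks with `k` steps: an element lies in the
`(k+1)`-st set when at least `d` elements above it lie in the `k`-th. -/
def richSet {α : Type*} (p : α → α → Prop) (d : ℝ) : ℕ → Set α
  | 0 => Set.univ
  | k + 1 => {x | d ≤ (Nat.card {y // p x y ∧ y ∈ richSet p d k} : ℝ)}

theorem richSet_succ_subset {α : Type*} [Finite α] (p : α → α → Prop) (d : ℝ) (k : ℕ) :
    richSet p d (k + 1) ⊆ richSet p d k := by
  induction k with
  | zero => exact Set.subset_univ _
  | succ k ih =>
    intro x hx
    refine le_trans (show d ≤ _ from hx) ?_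
    have hle : Nat.card {y // p x y ∧ y ∈ richSet p d (k + 1)} ≤
        Nat.card {y // p x y ∧ y ∈ richSet p d k} :=
      Nat.card_mono (Set.toFinite {y | p x y ∧ y ∈ richSet p d k})
        fun y hy => ⟨hy.1, ih hy.2⟩
    exact_mod_cast hle

theorem richSet_antitone {α : Type*} [Finite α] (p : α → α → Prop) (d : ℝ) :
    Antitone (richSet p d) :=
  antitone_nat_of_succ_le (richSet_succ_subset p d)

theorem mem_richSet_of_rel {α : Type*} [Finite α] {p : α → α → Prop} (hp : IsStrictOrd p)
    {d : ℝ} {k : ℕ} {x y : α} (hxy : p x y) (hy : y ∈ richSet p d k) : x ∈ richSet p d k := by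
  cases k with
  | zero => trivial
  | succ k =>
    refine le_trans (show d ≤ _ from hy) ?_
    have hle : Nat.card {z // p y z ∧ z ∈ richSet p d k} ≤
        Nat.card {z // p x z ∧ z ∈ richSet p d k} :=
      Nat.card_mono (Set.toFinite {z | p x z ∧ z ∈ richSet p d k})
        fun z hz => ⟨hp.2 hxy hz.1, hz.2⟩
    exact_mod_cast hle

theorem pow_le_card_paths_from {α : Type*} [Fintype α] {p : α → α → Prop} {d : ℝ} (hd : 0 ≤ d)
    (k : ℕ) (x : α) (hx : x ∈ richSet p d k) :
    d ^ k ≤ (Nat.card {f : Fin (k + 1) → α // IsPath p f ∧ f 0 = x} : ℝ) := by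
  classical
  induction k generalizing x with
  | zero =>
    have : Nonempty {f : Fin 1 → α // IsPath p f ∧ f 0 = x} :=
      ⟨fun _ => x, fun i j h => by omega, rfl⟩
    have hpos := Nat.card_pos (α := {f : Fin 1 → α // IsPath p f ∧ f 0 = x})
    rw [pow_zero]
    exact_mod_cast hpos
  | succ k ih =>
    have hle : Nat.card (Σ y : {y // p x y ∧ y ∈ richSet p d k},
          {f : Fin (k + 1) → α // IsPath p f ∧ f 0 = y.1}) ≤
        Nat.card {f : Fin (k + 2) → α // IsPath p f ∧ f 0 = x} := by
      refine Nat.card_le_card_of_injective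
        (fun s => ⟨Fin.cons (α := fun _ => α) x s.2.1, ?_, rfl⟩) ?_
      · intro i j hij
        induction j using Fin.cases with
        | zero => simp at hij
        | succ j =>
          induction i using Fin.cases with
          | zero =>
            have : j = 0 := by
              ext
              simpa using hij.symm
            subst this
            simpa [s.2.2.2] using s.1.2.1
          | succ i =>
            simpa using s.2.2.1 i j (by simpa using hij)
      · rintro ⟨⟨y, hy⟩, f, hf, hfy⟩ ⟨⟨z, hz⟩, g, hg, hgz⟩ hfg
        have : f = g := Fin.cons_right_injective (α := fun _ => α) x (Subtype.mk.inj hfg)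
        subst this
        have : y = z := hfy.symm.trans hgz
        subst this
        rfl
    rw [Nat.card_sigma] at hle
    have hle' : (∑ y : {y // p x y ∧ y ∈ richSet p d k},
        (Nat.card {f : Fin (k + 1) → α // IsPath p f ∧ f 0 = y.1} : ℝ)) ≤
        Nat.card {f : Fin (k + 2) → α // IsPath p f ∧ f 0 = x} := by exact_mod_cast hle
    refine le_trans ?_ hle'
    refine le_trans ?_ (Finset.sum_le_sum fun y _ => ih y.1 y.2.2)
    have hx' : d ≤ (Nat.card {y // p x y ∧ y ∈ richSet p d k} : ℝ) := hx
    rw [Finset.sum_const, nsmul_eq_mul, Finset.card_univ, ← Nat.card_eq_fintype_card, pow_succ']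
    gcongr

theorem pow_le_card_paths {α : Type*} [Fintype α] {p : α → α → Prop} {d : ℝ} (hd : 0 ≤ d)
    (k : ℕ) (hk : d ≤ (Nat.card (richSet p d k) : ℝ)) :
    d ^ (k + 1) ≤ (Nat.card {f : Fin (k + 1) → α // IsPath p f} : ℝ) := by
  classical
  have hle : Nat.card (Σ x : richSet p d k, {f : Fin (k + 1) → α // IsPath p f ∧ f 0 = x.1}) ≤
      Nat.card {f : Fin (k + 1) → α // IsPath p f} := by
    refine Nat.card_le_card_of_injective (fun s => ⟨s.2.1, s.2.2.1⟩) ?_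
    rintro ⟨⟨y, hy⟩, f, hf, hfy⟩ ⟨⟨z, hz⟩, g, hg, hgz⟩ hfg
    have : f = g := Subtype.mk.inj hfg
    subst this
    have : y = z := hfy.symm.trans hgz
    subst this
    rfl
  rw [Nat.card_sigma] at hle
  have hle' : (∑ x : richSet p d k,
      (Nat.card {f : Fin (k + 1) → α // IsPath p f ∧ f 0 = x.1} : ℝ)) ≤
      Nat.card {f : Fin (k + 1) → α // IsPath p f} := by exact_mod_cast hle
  refine le_trans ?_ hle'
  refine le_trans ?_ (Finset.sum_le_sum fun x _ => pow_le_card_paths_from hd k x.1 x.2)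
  rw [Finset.sum_const, nsmul_eq_mul, Finset.card_univ, ← Nat.card_eq_fintype_card, pow_succ']
  gcongr

/-- The subrelation of `p` keeping the edges that leave some `richSet` and do not start in
the `k`-th one. -/
def prunedRel {α : Type*} (p : α → α → Prop) (d : ℝ) (k : ℕ) (x y : α) : Prop :=
  p x y ∧ x ∉ richSet p d k ∧ ∃ i, x ∈ richSet p d i ∧ y ∉ richSet p d i

theorem isStrictOrd_prunedRel {α : Type*} [Finite α] {p : α → α → Prop} (hp : IsStrictOrd p)
    (d : ℝ) (k : ℕ) : IsStrictOrd (prunedRel p d k) := by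
  refine ⟨fun x h => hp.1 x h.1, ?_⟩
  rintro x y z ⟨hxy, hx, i, hxi, hyi⟩ ⟨hyz, -, -⟩
  exact ⟨hp.2 hxy hyz, hx, i, hxi, fun hz => hyi (mem_richSet_of_rel hp hyz hz)⟩

theorem not_hasChain_prunedRel {α : Type*} [Finite α] (p : α → α → Prop) (d : ℝ)
    {k : ℕ} (hk : 1 ≤ k) : ¬ HasChain (prunedRel p d k) (k + 1) := by
  rintro ⟨f, hf⟩
  have key : ∀ i, ∀ j : Fin (k + 1), j.val + i = k → f j ∈ richSet p d i := by
    intro i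
    induction i with
    | zero => exact fun _ _ => trivial
    | succ i ih =>
      intro j hj
      have hj' : j.val + 1 < k + 1 := by omega
      obtain ⟨-, -, m, hm, hm'⟩ := hf (i := j) (j := ⟨j.val + 1, hj'⟩) (by simp [Fin.lt_def])
      have h1 := ih ⟨j.val + 1, hj'⟩ (by simp only; omega)
      have him : i + 1 ≤ m := by
        by_contra hlt
        exact hm' (richSet_antitone p d (by omega) h1)
      exact richSet_antitone p d him hm
  have h0 := hf (i := 0) (j := Fin.last k) (by rw [Fin.lt_def]; exact hk)
  exact h0.2.1 (key k 0 (by simp))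

theorem removedEdges_prunedRel_le {α : Type*} [Fintype α] (p : α → α → Prop) {d : ℝ}
    (hd : 0 ≤ d) (k : ℕ) (hk : (Nat.card (richSet p d k) : ℝ) ≤ d) :
    (removedEdges p (prunedRel p d k) : ℝ) ≤ 2 * d * Fintype.card α := by
  classical
  have h1 : removedEdges p (prunedRel p d k) =
      ∑ x : α, Nat.card {y // p x y ∧ ¬ prunedRel p d k x y} := by
    rw [removedEdges, ← Nat.card_sigma]
    exact Nat.card_congr
      { toFun := fun e => ⟨e.1.1, e.1.2, e.2⟩
        invFun := fun e => ⟨(e.1, e.2.1), e.2.2⟩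
        left_inv := fun _ => rfl
        right_inv := fun _ => rfl }
  have h2 : ∀ x : α, (Nat.card {y // p x y ∧ ¬ prunedRel p d k x y} : ℝ) ≤
      (if x ∈ richSet p d k then (Fintype.card α : ℝ) else 0) + d := by
    intro x
    split_ifs with hx
    · have : Nat.card {y // p x y ∧ ¬ prunedRel p d k x y} ≤ Nat.card α :=
        Nat.card_le_card_of_injective _ Subtype.val_injective
      rw [Nat.card_eq_fintype_card (α := α)] at this
      have : (Nat.card {y // p x y ∧ ¬ prunedRel p d k x y} : ℝ) ≤ Fintype.card α := by
        exact_mod_cast this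
      linarith
    · have hex : ∃ i, x ∉ richSet p d i := ⟨k, hx⟩
      have hspec := Nat.find_spec hex
      obtain ⟨i, hi⟩ : ∃ i, Nat.find hex = i + 1 := by
        refine Nat.exists_eq_succ_of_ne_zero fun h0 => ?_
        rw [h0] at hspec
        exact hspec trivial
      have hxi : x ∈ richSet p d i := not_not.mp (Nat.find_min hex (by omega))
      rw [hi] at hspec
      have hlt : (Nat.card {y // p x y ∧ y ∈ richSet p d i} : ℝ) < d := not_le.mp hspec
      have hle : Nat.card {y // p x y ∧ ¬ prunedRel p d k x y} ≤
          Nat.card {y // p x y ∧ y ∈ richSet p d i} := by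
        refine Nat.card_le_card_of_injective (Subtype.map id fun y hy => ⟨hy.1, ?_⟩)
          (Subtype.map_injective _ Function.injective_id)
        by_contra hyi
        exact hy.2 ⟨hy.1, hx, i, hxi, hyi⟩
      have : (Nat.card {y // p x y ∧ ¬ prunedRel p d k x y} : ℝ) ≤
          Nat.card {y // p x y ∧ y ∈ richSet p d i} := by exact_mod_cast hle
      linarith
  rw [h1]
  push_cast
  refine (Finset.sum_le_sum fun x _ => h2 x).trans ?_
  rw [Finset.sum_add_distrib, ← Finset.sum_filter, Finset.sum_const, Finset.sum_const,
    nsmul_eq_mul, nsmul_eq_mul, Finset.card_univ, ← Fintype.card_subtype,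
    ← Nat.card_eq_fintype_card (α := {x // x ∈ richSet p d k})]
  have := mul_le_mul_of_nonneg_right hk (Nat.cast_nonneg (α := ℝ) (Fintype.card α))
  have e : (Nat.card {x // x ∈ richSet p d k} : ℝ) = Nat.card (richSet p d k) := rfl
  rw [e]
  linarith

/-! ### The density of a poset against the density of chains -/

theorem rel_of_blowup_path {α : Type*} {p : α → α → Prop} (hp : IsStrictOrd p) {w h : ℕ}
    {g : Fin w × Fin h → α}
    (hg : ∀ i j, ∀ k l : Fin h, k.val + 1 = l.val → p (g (i, k)) (g (j, l)))
    (i j : Fin w) {k l : Fin h} (hkl : k < l) : p (g (i, k)) (g (j, l)) := by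
  obtain ⟨l, hl⟩ := l
  induction l generalizing j with
  | zero => simp [Fin.lt_def] at hkl
  | succ l ih =>
    have hkl' : k.val < l + 1 := hkl
    rcases Nat.lt_succ_iff_lt_or_eq.mp hkl' with h1 | h1
    · exact hp.2 (ih i (by omega) h1) (hg i j ⟨l, by omega⟩ ⟨l + 1, hl⟩ rfl)
    · exact hg i j _ _ (by simp [h1])

theorem path_density_pow_le_homDensity {α β : Type*} [Fintype α] [Nonempty α] [Fintype β]
    {p : α → α → Prop} (hp : IsStrictOrd p) {q : β → β → Prop} (hq : IsStrictOrd q) :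
    ((Nat.card {f : Fin (posetHeight q) → α // IsPath p f} : ℝ) /
        (Fintype.card α : ℝ) ^ posetHeight q) ^ (posetWidth q ^ 2) ≤ homDensity q p := by
  obtain ⟨ι, hι, hmono⟩ := exists_grid_embedding hq
  refine (path_density_pow_le_blowup_density p _ _).trans ?_
  have := density_le_of_comp_embedding (α := α) ι hι
    (fun g => ∀ i j, ∀ k l : Fin (posetHeight q), k.val + 1 = l.val → p (g (i, k)) (g (j, l)))
    (IsPosetHom q p) (fun g hg x y hxy => rel_of_blowup_path hp hg _ _ (hmono hxy))
  rwa [Fintype.card_prod, Fintype.card_fin, Fintype.card_fin] at this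

theorem exists_chain_free_subposet {α β : Type*} [Fintype α] [Fintype β]
    {p : α → α → Prop} (hp : IsStrictOrd p) {q : β → β → Prop} (hq : IsStrictOrd q)
    (h2 : 2 ≤ posetHeight q) {ε : ℝ} (hε : 0 < ε)
    (hdens : homDensity q p < (ε / 2) ^ (posetHeight q * posetWidth q ^ 2)) :
    ∃ p' : α → α → Prop, IsStrictOrd p' ∧ SubposetRel p' p ∧
      (removedEdges p p' : ℝ) ≤ ε * (Fintype.card α : ℝ) ^ 2 ∧
      ¬ HasChain p' (posetHeight q) := by
  obtain ⟨k, hk⟩ : ∃ k, posetHeight q = k + 1 := ⟨posetHeight q - 1, by omega⟩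
  set d : ℝ := ε / 2 * Fintype.card α with hd
  have hd0 : 0 ≤ d := by positivity
  refine ⟨prunedRel p d k, isStrictOrd_prunedRel hp d k, fun x y h => h.1, ?_,
    hk ▸ not_hasChain_prunedRel p d (by omega)⟩
  have hsmall : (Nat.card (richSet p d k) : ℝ) ≤ d := by
    by_contra! hlt
    have hne : Nonempty α := by
      have : 0 < Nat.card (richSet p d k) := by exact_mod_cast hd0.trans_lt hlt
      exact ⟨((Nat.card_pos_iff.mp this).1.some).1⟩
    have hα : (0 : ℝ) < Fintype.card α := by exact_mod_cast Fintype.card_pos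
    have hpaths := pow_le_card_paths hd0 k hlt.le
    have hle := path_density_pow_le_homDensity hp hq
    refine absurd hdens (not_lt.mpr (le_trans ?_ hle))
    rw [pow_mul, hk]
    refine pow_le_pow_left₀ (by positivity) ?_ _
    rwa [le_div_iff₀ (by positivity), ← mul_pow]
  refine (removedEdges_prunedRel_le p hd0 k hsmall).trans (le_of_eq ?_)
  rw [hd]
  ring

/-- **Easy testability for monotone classes of posets** (Corollary 2).
If `Q ∈ Ps` realizes the height and width of the family `Ps` and
`t(Q,P) < (ε/2)^{h(Ps)·w(Ps)²}`, then one can remove at most `ε·|P|²` edges from `P`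
to obtain a `C_{h(Ps)}`-free (hence `Ps`-free) subposet. -/
theorem poset_family_removal (Ps : Set FinPoset) (Q : FinPoset) (hQmem : Q ∈ Ps)
    (hQh : posetHeight Q.rel = famHeight Ps) (hQw : posetWidth Q.rel = famWidth Ps)
    (h2 : 2 ≤ famHeight Ps)
    {α : Type*} [Fintype α] (p : α → α → Prop) (hp : IsStrictOrd p)
    (ε : ℝ) (hε : 0 < ε)
    (hdens : homDensity Q.rel p < (ε / 2) ^ (famHeight Ps * (famWidth Ps) ^ 2)) :
    ∃ p' : α → α → Prop, IsStrictOrd p' ∧ SubposetRel p' p ∧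
      (removedEdges p p' : ℝ) ≤ ε * (Fintype.card α : ℝ) ^ 2 ∧
      ¬ HasChain p' (famHeight Ps) ∧
      ∀ R ∈ Ps, ¬ ContainsAsSubposet R.rel p' := by
  obtain ⟨p', hp', hsub, hrem, hchain⟩ := exists_chain_free_subposet hp Q.strict
    (by omega) hε (by rwa [hQh, hQw])
  rw [hQh] at hchain
  refine ⟨p', hp', hsub, hrem, hchain, ?_⟩
  rintro R hR ⟨f, -, hf⟩
  obtain ⟨g, hg⟩ := (hasChain_posetHeight R.strict.1).mono
    (show famHeight Ps ≤ posetHeight R.rel from Nat.sInf_le ⟨R, hR, rfl⟩)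
  exact hchain ⟨f ∘ g, fun i j hij => hf (hg hij)⟩
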